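/- Fix an integer k ≥ 3 and a real δ ∈ (0,1). There exist c > 0 and N such that for every n ≥ N and every partition [n] = X ∪ Y the following hold. (a) The number of k-graphs H on [n] with E_H ⊆ K[X,Y] for which there exists a (k−2)-element set J ⊆ [n] with J ⊄ X and a set X₀ ⊆ X disjoint from J with |X₀| > δn and |e_{H_J}(X₀) − (1/2)·C(|X₀|,2)| > δ·(1/2)·C(|X₀|,2), or a (k−2)-element set J ⊆ [n] with J ⊄ Y and a set Y₀ ⊆ Y disjoint from J with |Y₀| > δn and |e_{H_J}(Y₀) − (1/2)·C(|Y₀|,2)| > δ·(1/2)·C(|Y₀|,2), is at most 2^{|K[X,Y]|} · 2^{−c·n²}. (b) Deterministically, for every k-graph H with E_H ⊆ K[X,Y], every (k−2)-element J ⊆ X and every X₀ ⊆ X disjoint from J satisfy e_{H_J}(X₀) = 0, and symmetrically with Y in place of X. -/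

import Mathlib

open Finset

/-- `H` is a `k`-graph on `[n]`: every edge is a `k`-element subset. -/
def IsKGraph (n k : ℕ) (H : Finset (Finset (Fin n))) : Prop :=
  ∀ e ∈ H, e.card = k

/-- `X, Y` is a bipartition of the hypergraph `H` on `[n]`. -/
def IsBipartition (n : ℕ) (H : Finset (Finset (Fin n))) (X Y : Finset (Fin n)) : Prop :=
  Disjoint X Y ∧ X ∪ Y = Finset.univ ∧ ∀ e ∈ H, ¬ e ⊆ X ∧ ¬ e ⊆ Y

/-- `B_n`: the collection of all bipartite `k`-graphs on `[n]`. -/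
def Bip (n k : ℕ) : Set (Finset (Finset (Fin n))) :=
  {H | IsKGraph n k H ∧ ∃ X Y : Finset (Fin n), IsBipartition n H X Y}

/-- `K[X,Y]`: the crossing `k`-sets, i.e. those contained neither in `X` nor in `Y`. -/
def crossing (n k : ℕ) (X Y : Finset (Fin n)) : Finset (Finset (Fin n)) :=
  (Finset.univ.powersetCard k).filter fun e => ¬ e ⊆ X ∧ ¬ e ⊆ Y

/-- joint `H`-degree of `u` and `v`: the number of `(k-1)`-sets `J ⊆ [n] \ {u,v}`
with `{u} ∪ J ∈ H` and `{v} ∪ J ∈ H`. -/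
def jointDeg (n k : ℕ) (H : Finset (Finset (Fin n))) (u v : Fin n) : ℕ :=
  (((Finset.univ \ {u, v}).powersetCard (k - 1)).filter
    fun J => insert u J ∈ H ∧ insert v J ∈ H).card

/-- `deg_H(v, U)`: the number of `(k-1)`-sets `J ⊆ U \ {v}` with `{v} ∪ J ∈ H`. -/
def degIn (n k : ℕ) (H : Finset (Finset (Fin n))) (v : Fin n) (U : Finset (Fin n)) : ℕ :=
  (((U \ {v}).powersetCard (k - 1)).filter fun J => insert v J ∈ H).card

/-- `e_{H_J}(A, B)`: for disjoint `A`, `B`, the number of link-graph edges of `H_J`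
with one endpoint in `A` and one in `B`. -/
def linkBetween (n : ℕ) (H : Finset (Finset (Fin n))) (J A B : Finset (Fin n)) : ℕ :=
  ((A ×ˢ B).filter fun p => p.1 ∉ J ∧ p.2 ∉ J ∧ insert p.1 (insert p.2 J) ∈ H).card

/-- `e_{H_J}(A)`: the number of link-graph edges of `H_J` contained in `A`. -/
def linkWithin (n : ℕ) (H : Finset (Finset (Fin n))) (J A : Finset (Fin n)) : ℕ :=
  ((A.powersetCard 2).filter fun p => Disjoint p J ∧ p ∪ J ∈ H).card

/-- The exponential moment of `2|H ∩ S| - |S|` over all subsets `H` of `K`. -/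
lemma sum_powerset_exp_inter {α : Type*} [DecidableEq α] {K S : Finset α} (hS : S ⊆ K) (t : ℝ) :
    ∑ H ∈ K.powerset, Real.exp (t * (2 * ((H ∩ S).card : ℝ) - S.card)) =
      2 ^ K.card * Real.cosh t ^ S.card := by
  have hprod : ∀ (A : Finset α) (x : ℝ),
      ∏ e ∈ A, (if e ∈ S then x else 1) = x ^ (A ∩ S).card := by
    intro A x
    rw [Finset.prod_ite_mem, Finset.prod_const]
  have hterm : ∀ H ∈ K.powerset, Real.exp (t * (2 * ((H ∩ S).card : ℝ) - S.card)) =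
      (∏ e ∈ H, if e ∈ S then Real.exp t else 1) *
        ∏ e ∈ K \ H, if e ∈ S then Real.exp (-t) else 1 := by
    intro H hH
    have hcard : ((K \ H) ∩ S).card + (H ∩ S).card = S.card := by
      have h := Finset.card_sdiff_add_card_inter S H
      have h1 : (K \ H) ∩ S = S \ H := by
        ext e
        have := @hS e
        simp only [mem_inter, mem_sdiff]
        tauto
      rw [h1, Finset.inter_comm H S, h]
    rw [hprod, hprod, ← Real.exp_nat_mul, ← Real.exp_nat_mul, ← Real.exp_add, ← hcard]
    push_cast
    ring_nf
  rw [Finset.sum_congr rfl hterm, ← Finset.prod_add]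
  have hfac : ∀ e ∈ K, ((if e ∈ S then Real.exp t else 1) + if e ∈ S then Real.exp (-t) else 1) =
      2 * if e ∈ S then Real.cosh t else 1 := by
    intro e _
    split_ifs
    · rw [Real.cosh_eq]; ring
    · norm_num
  rw [Finset.prod_congr rfl hfac, Finset.prod_mul_distrib, Finset.prod_const, hprod,
    Finset.inter_eq_right.2 hS]

/-- Chernoff's bound for the size of the trace on `S` of a uniformly random subset of `K`. -/
lemma card_powerset_filter_deviation_le {α : Type*} [DecidableEq α] {K S : Finset α} (hS : S ⊆ K)
    {δ : ℝ} (hδ : 0 < δ) :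
    ((K.powerset.filter fun H => δ * (1 / 2 * (S.card : ℝ)) <
        |((H ∩ S).card : ℝ) - 1 / 2 * S.card|).card : ℝ) ≤
      2 * (2 ^ K.card * Real.exp (-(δ ^ 2 * S.card / 2))) := by
  set F := K.powerset.filter fun H => δ * (1 / 2 * (S.card : ℝ)) <
    |((H ∩ S).card : ℝ) - 1 / 2 * S.card| with hF
  have hcosh : ∀ t : ℝ, t ^ 2 = δ ^ 2 →
      ∑ H ∈ K.powerset, Real.exp (t * (2 * ((H ∩ S).card : ℝ) - S.card)) ≤
        2 ^ K.card * Real.exp (δ ^ 2 * S.card / 2) := by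
    intro t ht
    rw [sum_powerset_exp_inter hS]
    gcongr
    calc Real.cosh t ^ S.card ≤ Real.exp (t ^ 2 / 2) ^ S.card := by
          gcongr
          exact Real.cosh_le_exp_half_sq t
      _ = Real.exp (δ ^ 2 * S.card / 2) := by
          rw [← Real.exp_nat_mul, ht]
          ring_nf
  have hmarkov : (F.card : ℝ) * Real.exp (δ ^ 2 * S.card) ≤
      2 * (2 ^ K.card * Real.exp (δ ^ 2 * S.card / 2)) := by
    calc (F.card : ℝ) * Real.exp (δ ^ 2 * S.card)
        = ∑ _H ∈ F, Real.exp (δ ^ 2 * S.card) := by rw [Finset.sum_const, nsmul_eq_mul]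
      _ ≤ ∑ H ∈ F, (Real.exp (δ * (2 * ((H ∩ S).card : ℝ) - S.card)) +
            Real.exp (-δ * (2 * ((H ∩ S).card : ℝ) - S.card))) := by
          refine Finset.sum_le_sum fun H hH => ?_
          have hdev := (Finset.mem_filter.1 hH).2
          rcases lt_abs.1 hdev with h | h
          · refine le_add_of_le_of_nonneg (Real.exp_le_exp.2 ?_) (Real.exp_pos _).le
            nlinarith
          · refine le_add_of_nonneg_of_le (Real.exp_pos _).le (Real.exp_le_exp.2 ?_)
            nlinarith
      _ ≤ ∑ H ∈ K.powerset, (Real.exp (δ * (2 * ((H ∩ S).card : ℝ) - S.card)) +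
            Real.exp (-δ * (2 * ((H ∩ S).card : ℝ) - S.card))) :=
          Finset.sum_le_sum_of_subset_of_nonneg (Finset.filter_subset _ _)
            fun H _ _ => by positivity
      _ ≤ 2 * (2 ^ K.card * Real.exp (δ ^ 2 * S.card / 2)) := by
          rw [Finset.sum_add_distrib, two_mul]
          exact add_le_add (hcosh δ rfl) (hcosh (-δ) (neg_sq δ))
  have hsplit : Real.exp (δ ^ 2 * S.card / 2) =
      Real.exp (-(δ ^ 2 * S.card / 2)) * Real.exp (δ ^ 2 * S.card) := by
    rw [← Real.exp_add]
    ring_nf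
  rw [hsplit, ← mul_assoc, ← mul_assoc] at hmarkov
  rw [← mul_assoc]
  exact le_of_mul_le_mul_right hmarkov (Real.exp_pos _)

lemma crossing_comm (n k : ℕ) (X Y : Finset (Fin n)) : crossing n k X Y = crossing n k Y X := by
  simp only [crossing, and_comm]

/-- The `|J| + 2`-sets formed by `J` and a pair contained in `A`. -/
def pairExtensions {n : ℕ} (J A : Finset (Fin n)) : Finset (Finset (Fin n)) :=
  (A.powersetCard 2).image (· ∪ J)

section pairExtensions

variable {n : ℕ} {J A : Finset (Fin n)}

lemma union_right_injOn_powersetCard (hJA : Disjoint J A) :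
    Set.InjOn (· ∪ J) (A.powersetCard 2 : Set (Finset (Fin n))) := by
  intro p hp q hq hpq
  have hdisj : ∀ r ∈ A.powersetCard 2, Disjoint r J := fun r hr =>
    (hJA.mono_right (mem_powersetCard.1 hr).1).symm
  rw [← Finset.union_sdiff_cancel_right (hdisj p hp), ← Finset.union_sdiff_cancel_right (hdisj q hq)]
  exact congrArg (· \ J) hpq

lemma card_pairExtensions (hJA : Disjoint J A) :
    (pairExtensions J A).card = A.card.choose 2 := by
  rw [pairExtensions, Finset.card_image_of_injOn (union_right_injOn_powersetCard hJA),
    Finset.card_powersetCard]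

lemma linkWithin_eq_card_inter (H : Finset (Finset (Fin n))) (hJA : Disjoint J A) :
    linkWithin n H J A = (H ∩ pairExtensions J A).card := by
  have himage : H ∩ pairExtensions J A =
      ((A.powersetCard 2).filter fun p => Disjoint p J ∧ p ∪ J ∈ H).image (· ∪ J) := by
    ext e
    simp only [pairExtensions, mem_inter, mem_image, mem_filter]
    constructor
    · rintro ⟨he, p, hp, rfl⟩
      exact ⟨p, ⟨hp, (hJA.mono_right (mem_powersetCard.1 hp).1).symm, he⟩, rfl⟩
    · rintro ⟨p, ⟨hp, _, he⟩, rfl⟩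
      exact ⟨he, p, hp, rfl⟩
  rw [himage, Finset.card_image_of_injOn, linkWithin]
  exact (union_right_injOn_powersetCard hJA).mono (Finset.coe_subset.2 (Finset.filter_subset _ _))

lemma pairExtensions_subset_crossing {k : ℕ} (hk : 2 ≤ k) {X Y : Finset (Fin n)}
    (hXY : Disjoint X Y) (hJ : J.card = k - 2) (hJX : ¬ J ⊆ X) (hA : A ⊆ X)
    (hJA : Disjoint J A) : pairExtensions J A ⊆ crossing n k X Y := by
  intro e he
  obtain ⟨p, hp, rfl⟩ := Finset.mem_image.1 he
  obtain ⟨hpA, hp2⟩ := mem_powersetCard.1 hp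
  simp only [crossing, mem_filter, mem_powersetCard, subset_univ, true_and]
  refine ⟨?_, fun h => hJX (Finset.union_subset_right h), fun h => ?_⟩
  · rw [Finset.card_union_of_disjoint (hJA.mono_right hpA).symm, hp2, hJ]
    omega
  · obtain ⟨a, ha⟩ : p.Nonempty := Finset.card_pos.1 (by omega)
    exact Finset.disjoint_left.1 hXY (hA (hpA ha)) (h (Finset.mem_union_left _ ha))

end pairExtensions

lemma sq_div_four_le_choose_two {x : ℝ} {m : ℕ} (hx : 2 ≤ x) (hm : x < m) :
    x ^ 2 / 4 ≤ (m.choose 2 : ℝ) := by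
  rw [Nat.cast_choose_two]
  nlinarith

/-- The edge sets in `K[X,Y]` with a link graph whose density deviates from `1/2` on a large
subset of `X`. -/
def irregularLinks (n k : ℕ) (δ : ℝ) (X Y : Finset (Fin n)) : Set (Finset (Finset (Fin n))) :=
  {H | H ⊆ crossing n k X Y ∧ ∃ J A : Finset (Fin n), J.card = k - 2 ∧ ¬ J ⊆ X ∧ A ⊆ X ∧
    Disjoint J A ∧ δ * n < (A.card : ℝ) ∧ δ * ((1 / 2 : ℝ) * (A.card.choose 2 : ℝ)) <
      |(linkWithin n H J A : ℝ) - (1 / 2 : ℝ) * (A.card.choose 2 : ℝ)|}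

lemma ncard_irregularLinks_le {n k : ℕ} (hk : 2 ≤ k) {δ : ℝ} (hδ : 0 < δ) (hn : 2 ≤ δ * n)
    {X Y : Finset (Fin n)} (hXY : Disjoint X Y) :
    ((irregularLinks n k δ X Y).ncard : ℝ) ≤
      2 ^ (2 * n) * (2 * (2 ^ (crossing n k X Y).card * Real.exp (-(δ ^ 4 * n ^ 2 / 8)))) := by
  classical
  set P : Finset (Finset (Fin n) × Finset (Fin n)) := Finset.univ.filter fun q =>
    q.1.card = k - 2 ∧ ¬ q.1 ⊆ X ∧ q.2 ⊆ X ∧ Disjoint q.1 q.2 ∧ δ * n < (q.2.card : ℝ) with hP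
  set F : Finset (Fin n) × Finset (Fin n) → Finset (Finset (Finset (Fin n))) := fun q =>
    (crossing n k X Y).powerset.filter fun H =>
      δ * (1 / 2 * ((pairExtensions q.1 q.2).card : ℝ)) <
        |((H ∩ pairExtensions q.1 q.2).card : ℝ) - 1 / 2 * (pairExtensions q.1 q.2).card|
    with hF
  have hsub : irregularLinks n k δ X Y ⊆ (P.biUnion F : Set (Finset (Finset (Fin n)))) := by
    rintro H ⟨hH, J, A, hJ, hJX, hA, hJA, hlarge, hdev⟩
    rw [linkWithin_eq_card_inter H hJA, ← card_pairExtensions hJA] at hdev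
    rw [Finset.mem_coe, Finset.mem_biUnion]
    exact ⟨(J, A), by simp [hP, hJ, hJX, hA, hJA, hlarge],
      Finset.mem_filter.2 ⟨Finset.mem_powerset.2 hH, hdev⟩⟩
  have hFcard : ∀ q ∈ P, ((F q).card : ℝ) ≤
      2 * (2 ^ (crossing n k X Y).card * Real.exp (-(δ ^ 4 * n ^ 2 / 8))) := by
    intro q hq
    obtain ⟨-, hJ, hJX, hA, hJA, hlarge⟩ := Finset.mem_filter.1 hq
    refine (card_powerset_filter_deviation_le
      (pairExtensions_subset_crossing hk hXY hJ hJX hA hJA) hδ).trans ?_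
    rw [card_pairExtensions hJA]
    have hchoose := sq_div_four_le_choose_two hn hlarge
    have hexp : δ ^ 4 * n ^ 2 / 8 ≤ δ ^ 2 * (q.2.card.choose 2 : ℝ) / 2 := by
      linarith [mul_le_mul_of_nonneg_left hchoose (sq_nonneg δ)]
    have := Real.exp_le_exp.2 (neg_le_neg hexp)
    gcongr
  have hPcard : (P.card : ℝ) ≤ 2 ^ (2 * n) := by
    have h : P.card ≤ 2 ^ (2 * n) := (Finset.card_filter_le _ _).trans_eq (by
      rw [Finset.card_univ, Fintype.card_prod, Fintype.card_finset, Fintype.card_fin]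
      ring)
    exact_mod_cast h
  calc ((irregularLinks n k δ X Y).ncard : ℝ) ≤ ((P.biUnion F).card : ℝ) := by
        exact_mod_cast (Set.ncard_le_ncard hsub (Finset.finite_toSet _)).trans_eq
          (Set.ncard_coe_finset _)
    _ ≤ ∑ q ∈ P, ((F q).card : ℝ) := by exact_mod_cast Finset.card_biUnion_le
    _ ≤ P.card * (2 * (2 ^ (crossing n k X Y).card * Real.exp (-(δ ^ 4 * n ^ 2 / 8)))) := by
        rw [← nsmul_eq_mul]
        exact Finset.sum_le_card_nsmul _ _ _ hFcard
    _ ≤ _ := by gcongr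

lemma exp_neg_le_two_rpow_neg {a : ℝ} (ha : 0 ≤ a) : Real.exp (-a) ≤ (2 : ℝ) ^ (-a) := by
  rw [Real.rpow_def_of_pos two_pos]
  refine Real.exp_le_exp.2 ?_
  nlinarith [Real.log_two_lt_d9]

/-- A `k`-graph without edges inside `X` has no link edges inside `X` over sets `J ⊆ X`. -/
lemma linkWithin_eq_zero {n k : ℕ} {X Y J A : Finset (Fin n)} {H : Finset (Finset (Fin n))}
    (hH : H ⊆ crossing n k X Y) (hJ : J ⊆ X) (hA : A ⊆ X) : linkWithin n H J A = 0 := by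
  rw [linkWithin, Finset.card_eq_zero, Finset.filter_eq_empty_iff]
  rintro p hp ⟨-, he⟩
  exact (Finset.mem_filter.1 (hH he)).2.1
    (Finset.union_subset ((mem_powersetCard.1 hp).1.trans hA) hJ)

theorem stmt11 (k : ℕ) (hk : 3 ≤ k) (δ : ℝ) (hδ0 : 0 < δ) (hδ1 : δ < 1) :
    (∃ c : ℝ, 0 < c ∧ ∃ N : ℕ, ∀ n : ℕ, N ≤ n →
      ∀ X Y : Finset (Fin n), Disjoint X Y → X ∪ Y = Finset.univ →
        (({H : Finset (Finset (Fin n)) | H ⊆ crossing n k X Y ∧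
            ((∃ J X₀ : Finset (Fin n), J.card = k - 2 ∧ ¬ J ⊆ X ∧ X₀ ⊆ X ∧ Disjoint J X₀ ∧
                δ * n < (X₀.card : ℝ) ∧
                δ * ((1 / 2 : ℝ) * (X₀.card.choose 2 : ℝ)) <
                  |(linkWithin n H J X₀ : ℝ) - (1 / 2 : ℝ) * (X₀.card.choose 2 : ℝ)|) ∨
             (∃ J Y₀ : Finset (Fin n), J.card = k - 2 ∧ ¬ J ⊆ Y ∧ Y₀ ⊆ Y ∧ Disjoint J Y₀ ∧
                δ * n < (Y₀.card : ℝ) ∧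
                δ * ((1 / 2 : ℝ) * (Y₀.card.choose 2 : ℝ)) <
                  |(linkWithin n H J Y₀ : ℝ) -
                    (1 / 2 : ℝ) * (Y₀.card.choose 2 : ℝ)|))}.ncard : ℝ))
          ≤ (2 : ℝ) ^ ((crossing n k X Y).card) * (2 : ℝ) ^ (-(c * (n : ℝ) ^ 2))) ∧
    (∀ n : ℕ, ∀ X Y : Finset (Fin n), Disjoint X Y → X ∪ Y = Finset.univ →
      ∀ H : Finset (Finset (Fin n)), H ⊆ crossing n k X Y →
        (∀ J : Finset (Fin n), J ⊆ X → J.card = k - 2 →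
          ∀ X₀ : Finset (Fin n), X₀ ⊆ X → Disjoint J X₀ → linkWithin n H J X₀ = 0) ∧
        (∀ J : Finset (Fin n), J ⊆ Y → J.card = k - 2 →
          ∀ Y₀ : Finset (Fin n), Y₀ ⊆ Y → Disjoint J Y₀ → linkWithin n H J Y₀ = 0)) := by
  refine ⟨⟨δ ^ 4 / 16, by positivity, ⌈64 / δ ^ 4⌉₊, ?_⟩, ?_⟩
  · intro n hN X Y hXY _
    have hn : 64 ≤ δ ^ 4 * n := by
      have h := (div_le_iff₀ (by positivity)).1 (Nat.ceil_le.1 hN)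
      linarith
    have hδ4 : δ ^ 4 ≤ δ := pow_le_of_le_one hδ0.le hδ1.le (by norm_num)
    have hn2 : 2 ≤ δ * n := by
      nlinarith [mul_le_mul_of_nonneg_right hδ4 (Nat.cast_nonneg (α := ℝ) n)]
    have hn1 : (1 : ℝ) ≤ n := by nlinarith [Nat.cast_nonneg (α := ℝ) n]
    have hX := ncard_irregularLinks_le (by omega : 2 ≤ k) hδ0 hn2 hXY
    have hY := ncard_irregularLinks_le (by omega : 2 ≤ k) hδ0 hn2 hXY.symm
    rw [crossing_comm n k Y X] at hY
    have hunion : ∀ s : Set (Finset (Finset (Fin n))),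
        s ⊆ irregularLinks n k δ X Y ∪ irregularLinks n k δ Y X →
        (s.ncard : ℝ) ≤ (irregularLinks n k δ X Y).ncard + (irregularLinks n k δ Y X).ncard := by
      intro s hs
      exact_mod_cast (Set.ncard_le_ncard hs (Set.toFinite _)).trans (Set.ncard_union_le _ _)
    refine (hunion _ ?_).trans ((add_le_add hX hY).trans ?_)
    · rintro H ⟨hH, h | h⟩
      · exact Or.inl ⟨hH, h⟩
      · exact Or.inr ⟨crossing_comm n k X Y ▸ hH, h⟩
    calc _ = (2 : ℝ) ^ (crossing n k X Y).card *
          (2 ^ (2 * n + 2) * Real.exp (-(δ ^ 4 * n ^ 2 / 8))) := by ring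
      _ ≤ 2 ^ (crossing n k X Y).card *
          ((2 : ℝ) ^ ((2 * n + 2 : ℕ) : ℝ) * (2 : ℝ) ^ (-(δ ^ 4 * n ^ 2 / 8))) := by
          rw [Real.rpow_natCast]
          gcongr
          exact exp_neg_le_two_rpow_neg (by positivity)
      _ ≤ 2 ^ (crossing n k X Y).card * (2 : ℝ) ^ (-(δ ^ 4 / 16 * (n : ℝ) ^ 2)) := by
          rw [← Real.rpow_add two_pos]
          gcongr
          · norm_num
          · push_cast
            nlinarith [mul_le_mul_of_nonneg_right hn (Nat.cast_nonneg (α := ℝ) n)]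
  · intro n X Y _ _ H hH
    exact ⟨fun J hJ _ A hA _ => linkWithin_eq_zero hH hJ hA,
      fun J hJ _ A hA _ => linkWithin_eq_zero (crossing_comm n k X Y ▸ hH) hJ hA⟩
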